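/- arXiv:1904.08470 — 2 statements merged into one kernel-verified Lean document; each statement's English description precedes it below -/
import Mathlib

section
/- The alternating bilinear bracket on the 12-dimensional complex vector space with basis $u_1,\dots,u_{12}$ determined by $[u_2,u_1]=u_6-u_4$, $[u_3,u_2]=u_7-u_5$, $[u_4,u_3]=u_8-u_{10}$, $[u_5,u_1]=u_{11}-u_8$, $[u_5,u_4]=u_{12}$, $[u_6,u_3]=u_{11}-u_9$, $[u_7,u_1]=u_9-u_{10}$, $[u_7,u_6]=-u_{12}$, $[u_{10},u_2]=-u_{12}$, $[u_{11},u_2]=u_{12}$, and $[u_i,u_j]=0$ for all other pairs of basis elements with $i>j$, satisfies the Jacobi identity, and hence defines a complex Lie algebra $\widetilde{\mathfrak{n}}(A_3)$. -/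
open Fin.NatCast in
/-- The basis vector `u k` (1-based index `k`) of `ℂ^12`. -/
noncomputable def u (k : ℕ) : Fin 12 → ℂ := Pi.single ((k - 1 : ℕ) : Fin 12) 1

/-- Structure constants: `cUp i j` is the value of `[u i, u j]` for `i > j` (1-based). -/
noncomputable def cUp : ℕ → ℕ → (Fin 12 → ℂ)
  | 2, 1 => u 6 - u 4
  | 3, 2 => u 7 - u 5
  | 4, 3 => u 8 - u 10
  | 5, 1 => u 11 - u 8
  | 5, 4 => u 12
  | 6, 3 => u 11 - u 9
  | 7, 1 => u 9 - u 10
  | 7, 6 => -u 12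
  | 10, 2 => -u 12
  | 11, 2 => u 12
  | _, _ => 0

/-- Antisymmetric extension of the structure constants. -/
noncomputable def c (i j : ℕ) : Fin 12 → ℂ :=
  if j < i then cUp i j else if i < j then -cUp j i else 0

/-- The bilinear bracket on `ℂ^12` determined by the structure constants. -/
noncomputable def br (x y : Fin 12 → ℂ) : Fin 12 → ℂ :=
  ∑ i : Fin 12, ∑ j : Fin 12, (x i * y j) • c ((i : ℕ) + 1) ((j : ℕ) + 1)

/-- Coordinates of the bracket. -/
theorem br_eq (x y : Fin 12 → ℂ) : br x y =
    ![0, 0, 0, -(x 1 * y 0 - x 0 * y 1), -(x 2 * y 1 - x 1 * y 2),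
      x 1 * y 0 - x 0 * y 1, x 2 * y 1 - x 1 * y 2,
      (x 3 * y 2 - x 2 * y 3) - (x 4 * y 0 - x 0 * y 4),
      (x 6 * y 0 - x 0 * y 6) - (x 5 * y 2 - x 2 * y 5),
      -(x 3 * y 2 - x 2 * y 3) - (x 6 * y 0 - x 0 * y 6),
      (x 4 * y 0 - x 0 * y 4) + (x 5 * y 2 - x 2 * y 5),
      (x 4 * y 3 - x 3 * y 4) - (x 6 * y 5 - x 5 * y 6)
        - (x 9 * y 1 - x 1 * y 9) + (x 10 * y 1 - x 1 * y 10)] := by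
  unfold br
  simp [Fin.sum_univ_succ, c, cUp, Fin.succ]
  ext k
  fin_cases k <;> simp [u, Pi.single_apply, Fin.ext_iff] <;> ring

theorem stmt_6 :
    (∀ x : Fin 12 → ℂ, br x x = 0) ∧
    (∀ x y z : Fin 12 → ℂ,
      br x (br y z) + br y (br z x) + br z (br x y) = 0) := by
  constructor
  · intro x
    rw [br_eq]
    ext k
    fin_cases k <;> simp <;> ring
  · intro x y z
    rw [br_eq y z, br_eq z x, br_eq x y]
    simp only [br_eq]
    ext k
    fin_cases k <;> simp [Matrix.vecHead, Matrix.vecTail] <;> ring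
end

section
/- The Lie algebra $\widetilde{\mathfrak{n}}(A_3)$ is nilpotent of class 3: its lower central series, defined by $\mathfrak{n}_0 = \widetilde{\mathfrak{n}}(A_3)$ and $\mathfrak{n}_{i+1} = [\widetilde{\mathfrak{n}}(A_3), \mathfrak{n}_i]$, satisfies $\mathfrak{n}_1 = \mathrm{span}\{u_6-u_4,\ u_{11}-u_8,\ u_9-u_{10},\ u_7-u_5,\ u_{12},\ u_8-u_{10}\}$ of dimension 6, $\mathfrak{n}_2 = \mathrm{span}\{u_8+u_9-u_{10}-u_{11},\ u_{12}\}$ of dimension 2, and $\mathfrak{n}_3 = 0$. -/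
/-- Lower central series: `lcs 0 = ⊤`, `lcs (i+1) = [𝔫, lcs i]`. -/
noncomputable def lcs : ℕ → Submodule ℂ (Fin 12 → ℂ)
  | 0 => ⊤
  | i + 1 => Submodule.span ℂ {z | ∃ x y, y ∈ lcs i ∧ z = br x y}

/-- Explicit form of the bracket. -/
theorem br_formula (x y : Fin 12 → ℂ) : br x y =
    (x 1 * y 0 - x 0 * y 1) • (u 6 - u 4) + (x 2 * y 1 - x 1 * y 2) • (u 7 - u 5)
    + (x 3 * y 2 - x 2 * y 3) • (u 8 - u 10) + (x 4 * y 0 - x 0 * y 4) • (u 11 - u 8)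
    + (x 4 * y 3 - x 3 * y 4) • u 12 + (x 5 * y 2 - x 2 * y 5) • (u 11 - u 9)
    + (x 6 * y 0 - x 0 * y 6) • (u 9 - u 10) - (x 6 * y 5 - x 5 * y 6) • u 12
    - (x 9 * y 1 - x 1 * y 9) • u 12 + (x 10 * y 1 - x 1 * y 10) • u 12 := by
  have key : ∀ f : Fin 12 → Fin 12 → (Fin 12 → ℂ), (∑ i, ∑ j, f i j) =
      ∑ i, (f i 0 + f i 1 + f i 2 + f i 3 + f i 4 + f i 5 + f i 6 + f i 7 + f i 8 + f i 9
        + f i 10 + f i 11) := by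
    intro f
    refine Finset.sum_congr rfl fun i _ => ?_
    simp [Fin.sum_univ_succ, add_assoc]
  unfold br
  rw [key]
  simp only [Fin.sum_univ_succ, Finset.univ_eq_empty, Finset.sum_empty]
  simp [c, cUp]
  module

/-- The coordinate functions of the basis vectors. -/
theorem u_apply (k : ℕ) (hk : 1 ≤ k ∧ k ≤ 12) (i : Fin 12) :
    u k i = if (i : ℕ) + 1 = k then 1 else 0 := by
  obtain ⟨h1, h2⟩ := hk
  unfold u
  rw [Pi.single_apply]
  congr 1
  rw [Fin.ext_iff, Fin.val_natCast, Nat.mod_eq_of_lt (by omega)]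
  apply propext
  omega

/-- The bracket of two basis vectors. -/
theorem br_u (i j : ℕ) (hi : 1 ≤ i ∧ i ≤ 12) (hj : 1 ≤ j ∧ j ≤ 12) :
    br (u i) (u j) = c i j := by
  unfold br
  rw [Finset.sum_eq_single (⟨i - 1, by omega⟩ : Fin 12),
    Finset.sum_eq_single (⟨j - 1, by omega⟩ : Fin 12)]
  · rw [u_apply i hi, u_apply j hj]
    simp [Nat.sub_add_cancel hi.1, Nat.sub_add_cancel hj.1]
  · intro b _ hb
    rw [u_apply j hj, if_neg]
    · simp
    · intro h; apply hb; ext; simp; omega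
  · simp
  · intro b _ hb
    rw [u_apply i hi, if_neg]
    · simp
    · intro h; apply hb; ext; simp; omega
  · simp

theorem br_mem_lcs (n : ℕ) (x y : Fin 12 → ℂ) (hy : y ∈ lcs n) : br x y ∈ lcs (n + 1) := by
  rw [lcs]
  exact Submodule.subset_span ⟨x, y, hy, rfl⟩

theorem c_mem (i j : ℕ) (hi : 1 ≤ i ∧ i ≤ 12) (hj : 1 ≤ j ∧ j ≤ 12) : c i j ∈ lcs 1 := by
  rw [← br_u i j hi hj]
  exact br_mem_lcs 0 _ _ (by simp [lcs])

theorem lcs_one : lcs 1 = Submodule.span ℂ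
      ({u 6 - u 4, u 11 - u 8, u 9 - u 10, u 7 - u 5, u 12, u 8 - u 10} : Set (Fin 12 → ℂ)) := by
  apply le_antisymm
  · rw [lcs, Submodule.span_le]
    rintro z ⟨x, y, -, rfl⟩
    rw [SetLike.mem_coe, br_formula]
    set S := Submodule.span ℂ
      ({u 6 - u 4, u 11 - u 8, u 9 - u 10, u 7 - u 5, u 12, u 8 - u 10} : Set (Fin 12 → ℂ)) with hS
    have h1 : u 6 - u 4 ∈ S := Submodule.subset_span (by simp)
    have h2 : u 11 - u 8 ∈ S := Submodule.subset_span (by simp)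
    have h3 : u 9 - u 10 ∈ S := Submodule.subset_span (by simp)
    have h4 : u 7 - u 5 ∈ S := Submodule.subset_span (by simp)
    have h5 : u 12 ∈ S := Submodule.subset_span (by simp)
    have h6 : u 8 - u 10 ∈ S := Submodule.subset_span (by simp)
    have h7 : u 11 - u 9 ∈ S := by
      have := S.sub_mem (S.add_mem h2 h6) h3
      convert this using 1
      abel
    clear_value S
    repeat' first
      | assumption
      | apply Submodule.add_mem
      | apply Submodule.sub_mem
      | apply Submodule.smul_mem
  · rw [Submodule.span_le]
    intro z hz
    simp only [Set.mem_insert_iff, Set.mem_singleton_iff] at hz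
    rw [SetLike.mem_coe]
    rcases hz with rfl | rfl | rfl | rfl | rfl | rfl
    · simpa [c, cUp] using c_mem 2 1 (by norm_num) (by norm_num)
    · simpa [c, cUp] using c_mem 5 1 (by norm_num) (by norm_num)
    · simpa [c, cUp] using c_mem 7 1 (by norm_num) (by norm_num)
    · simpa [c, cUp] using c_mem 3 2 (by norm_num) (by norm_num)
    · simpa [c, cUp] using c_mem 5 4 (by norm_num) (by norm_num)
    · simpa [c, cUp] using c_mem 4 3 (by norm_num) (by norm_num)

/-- Linear equations satisfied by the elements of the derived algebra. -/
theorem lcs_one_eqs (y : Fin 12 → ℂ) (hy : y ∈ lcs 1) :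
    y 0 = 0 ∧ y 1 = 0 ∧ y 2 = 0 ∧ y 5 = - y 3 ∧ y 6 = - y 4 := by
  rw [lcs_one] at hy
  induction hy using Submodule.span_induction with
  | mem z hz =>
    simp only [Set.mem_insert_iff, Set.mem_singleton_iff] at hz
    rcases hz with rfl | rfl | rfl | rfl | rfl | rfl <;> simp [u_apply]
  | zero => simp
  | add a b _ _ ha hb =>
    obtain ⟨a1, a2, a3, a4, a5⟩ := ha
    obtain ⟨b1, b2, b3, b4, b5⟩ := hb
    simp only [Pi.add_apply, a1, a2, a3, a4, a5, b1, b2, b3, b4, b5]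
    refine ⟨?_, ?_, ?_, ?_, ?_⟩ <;> ring
  | smul t a _ ha =>
    obtain ⟨a1, a2, a3, a4, a5⟩ := ha
    simp [a1, a2, a3, a4, a5]

theorem lcs_two : lcs 2 = Submodule.span ℂ
      ({u 8 + u 9 - u 10 - u 11, u 12} : Set (Fin 12 → ℂ)) := by
  apply le_antisymm
  · rw [lcs, Submodule.span_le]
    rintro z ⟨x, y, hy, rfl⟩
    obtain ⟨h0, h1, h2, h5, h6⟩ := lcs_one_eqs y hy
    rw [SetLike.mem_coe, br_formula, Submodule.mem_span_pair, h0, h1, h2, h5, h6]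
    refine ⟨x 0 * y 4 - x 2 * y 3, x 4 * y 3 - x 3 * y 4 + x 6 * y 3 - x 5 * y 4
      + x 1 * y 9 - x 1 * y 10, ?_⟩
    module
  · rw [Submodule.span_le]
    intro z hz
    simp only [Set.mem_insert_iff, Set.mem_singleton_iff] at hz
    have hmem : u 6 - u 4 ∈ lcs 1 := by
      rw [lcs_one]; exact Submodule.subset_span (by simp)
    rw [SetLike.mem_coe]
    rcases hz with rfl | rfl
    · have := br_mem_lcs 1 (u 3) _ hmem
      rw [br_formula] at this
      simp [u_apply] at this
      convert this using 1
      abel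
    · have := br_mem_lcs 1 (-u 5) _ hmem
      rw [br_formula] at this
      simpa [u_apply] using this

theorem lcs_two_eqs (y : Fin 12 → ℂ) (hy : y ∈ lcs 2) :
    y 0 = 0 ∧ y 1 = 0 ∧ y 2 = 0 ∧ y 3 = 0 ∧ y 4 = 0 ∧ y 5 = 0 ∧ y 6 = 0 ∧ y 9 = y 10 := by
  rw [lcs_two, Submodule.mem_span_pair] at hy
  obtain ⟨a, b, rfl⟩ := hy
  simp [u_apply]

theorem lcs_three : lcs 3 = ⊥ := by
  rw [lcs, Submodule.span_eq_bot]
  rintro z ⟨x, y, hy, rfl⟩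
  obtain ⟨h0, h1, h2, h3, h4, h5, h6, h9⟩ := lcs_two_eqs y hy
  rw [br_formula, h0, h1, h2, h3, h4, h5, h6, h9]
  module

theorem finrank_one : Module.finrank ℂ ↥(lcs 1) = 6 := by
  have hli : LinearIndependent ℂ
      ![u 6 - u 4, u 11 - u 8, u 9 - u 10, u 7 - u 5, u 12, u 8 - u 10] := by
    rw [Fintype.linearIndependent_iff]
    intro g hg
    have e3 := congrFun hg 3
    have e10 := congrFun hg 10
    have e8 := congrFun hg 8
    have e4 := congrFun hg 4
    have e11 := congrFun hg 11
    have e7 := congrFun hg 7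
    simp [Fin.sum_univ_six, u_apply] at e3 e10 e8 e4 e11 e7
    rw [e10] at e7
    intro i
    fin_cases i <;> simp_all
  have h := finrank_span_eq_card hli
  have hr : Set.range ![u 6 - u 4, u 11 - u 8, u 9 - u 10, u 7 - u 5, u 12, u 8 - u 10] =
      {u 6 - u 4, u 11 - u 8, u 9 - u 10, u 7 - u 5, u 12, u 8 - u 10} := by
    simp only [Matrix.range_cons, Matrix.range_empty, Set.union_empty, Set.singleton_union]
  rw [hr] at h
  rw [lcs_one, h, Fintype.card_fin]

theorem finrank_two : Module.finrank ℂ ↥(lcs 2) = 2 := by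
  have hli : LinearIndependent ℂ ![u 8 + u 9 - u 10 - u 11, u 12] := by
    rw [Fintype.linearIndependent_iff]
    intro g hg
    have e7 := congrFun hg 7
    have e11 := congrFun hg 11
    simp [Fin.sum_univ_two, u_apply] at e7 e11
    intro i
    fin_cases i <;> simp_all
  have h := finrank_span_eq_card hli
  have hr : Set.range ![u 8 + u 9 - u 10 - u 11, u 12] =
      {u 8 + u 9 - u 10 - u 11, u 12} := by
    simp only [Matrix.range_cons, Matrix.range_empty, Set.union_empty, Set.singleton_union]
  rw [hr] at h
  rw [lcs_two, h, Fintype.card_fin]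

theorem stmt_7 :
    lcs 1 = Submodule.span ℂ
      ({u 6 - u 4, u 11 - u 8, u 9 - u 10, u 7 - u 5, u 12, u 8 - u 10} : Set (Fin 12 → ℂ)) ∧
    Module.finrank ℂ ↥(lcs 1) = 6 ∧
    lcs 2 = Submodule.span ℂ
      ({u 8 + u 9 - u 10 - u 11, u 12} : Set (Fin 12 → ℂ)) ∧
    Module.finrank ℂ ↥(lcs 2) = 2 ∧
    lcs 3 = ⊥ :=
  ⟨lcs_one, finrank_one, lcs_two, finrank_two, lcs_three⟩
end
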